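/- Let ν > -1 be a real number. For every x > 0, the infinite product over all positive zeros j of J_ν of (1 − x⁴/j⁴) converges and equals 2^{2ν} · Γ(ν + 1)² · x^{−2ν} · J_ν(x) · I_ν(x). -/

import Mathlib

/-- The Bessel function of the first kind of order `ν`, defined for `x > 0` by its series. -/
noncomputable def besselJ (ν x : ℝ) : ℝ :=
  ∑' m : ℕ, ((-1 : ℝ) ^ m / (m.factorial * Real.Gamma (m + ν + 1))) *
    (x / 2) ^ (2 * (m : ℝ) + ν)

/-- The modified Bessel function of the first kind of order `ν`, defined for `x > 0`
by its series. -/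
noncomputable def besselI (ν x : ℝ) : ℝ :=
  ∑' m : ℕ, (1 / (m.factorial * Real.Gamma (m + ν + 1))) *
    (x / 2) ^ (2 * (m : ℝ) + ν)

open Filter Topology Metric

lemma zeros_finite (f : ℂ → ℂ) (hf : Differentiable ℂ f) (h0 : f 0 = 1) (R : ℝ) :
    {a : ℂ | f a = 0 ∧ ‖a‖ ≤ R}.Finite := by
  by_contra hinf
  obtain ⟨x, -, hx⟩ := Set.Infinite.exists_accPt_of_subset_isCompact (K := closedBall (0:ℂ) R)
    hinf (isCompact_closedBall _ _) (fun a ha => by simpa using ha.2)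
  rw [accPt_iff_frequently_nhdsNE] at hx
  have h1 : AnalyticOnNhd ℂ f Set.univ := fun z _ => hf.analyticAt z
  have := h1.eqOn_zero_of_preconnected_of_frequently_eq_zero isPreconnected_univ (Set.mem_univ x)
    (hx.mono fun a ha => ha.1)
  have := this (Set.mem_univ 0)
  simp [h0] at this

lemma divide_zeros (f : ℂ → ℂ) (hf : Differentiable ℂ f) (h0 : f 0 = 1) (T : Finset ℂ)
    (hT : ∀ a ∈ T, f a = 0) :
    ∃ g : ℂ → ℂ, Differentiable ℂ g ∧ ∀ z, f z = (∏ a ∈ T, (1 - z / a)) * g z := by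
  classical
  induction T using Finset.induction_on with
  | empty => exact ⟨f, hf, by simp⟩
  | insert b T hb ih =>
    obtain ⟨g, hg, hfg⟩ := ih (fun a ha => hT a (Finset.mem_insert_of_mem ha))
    have hne : ∀ a ∈ insert b T, a ≠ 0 := by
      rintro a ha rfl
      have := hT 0 ha
      simp [h0] at this
    have hb0 := hne b (Finset.mem_insert_self _ _)
    have hgb : g b = 0 := by
      have h1 := hfg b
      rw [hT b (Finset.mem_insert_self _ _)] at h1
      refine (mul_eq_zero.1 h1.symm).resolve_left ?_
      refine Finset.prod_ne_zero_iff.2 ?_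
      intro a ha h
      have ha0 := hne a (Finset.mem_insert_of_mem ha)
      field_simp at h
      apply hb
      rw [mul_zero, sub_eq_zero] at h
      rwa [← h]
    refine ⟨fun z => -b * dslope g b z, ?_, ?_⟩
    · have : DifferentiableOn ℂ (dslope g b) Set.univ :=
        (Complex.differentiableOn_dslope univ_mem).2 hg.differentiableOn
      exact (differentiableOn_univ.1 this).const_mul _
    · intro z
      have h2 := sub_smul_dslope g b z
      rw [hgb, sub_zero, smul_eq_mul] at h2
      rw [hfg, Finset.prod_insert hb, ← h2]
      field_simp
      ring

lemma divide_ne_zero (f : ℂ → ℂ) (h0 : f 0 = 1) (T : Finset ℂ)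
    (hs : ∀ a, f a = 0 → deriv f a ≠ 0) (g : ℂ → ℂ)
    (hg : Differentiable ℂ g) (hfg : ∀ z, f z = (∏ a ∈ T, (1 - z / a)) * g z)
    (z : ℂ) (hz : f z = 0 → z ∈ T) : g z ≠ 0 := by
  classical
  intro hgz
  have hfz : f z = 0 := by rw [hfg, hgz, mul_zero]
  have hzT := hz hfz
  have hz0 : z ≠ 0 := by
    rintro rfl
    simp [h0] at hfz
  apply hs z hfz
  have e : f = fun w => ((1 - w / z) * ∏ a ∈ T.erase z, (1 - w / a)) * g w := by
    funext w
    rw [hfg, ← Finset.mul_prod_erase T _ hzT]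
  have h1 : DifferentiableAt ℂ (fun w => ∏ a ∈ T.erase z, (1 - w / a)) z := by fun_prop
  have h2 : DifferentiableAt ℂ (fun w : ℂ => 1 - w / z) z := by fun_prop
  rw [e]
  have := ((h2.hasDerivAt.mul h1.hasDerivAt).mul (hg z).hasDerivAt).deriv
  refine Eq.trans this ?_
  simp [hgz, div_self hz0]

lemma exists_log_ball (g : ℂ → ℂ) (hg : Differentiable ℂ g) (h0 : g 0 = 1) (R : ℝ) (hR : 0 < R)
    (hne : ∀ z ∈ ball (0:ℂ) R, g z ≠ 0) :
    ∃ h : ℂ → ℂ, DifferentiableOn ℂ h (ball 0 R) ∧ h 0 = 0 ∧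
      ∀ z ∈ ball (0:ℂ) R, g z = Complex.exp (h z) := by
  have hd : DifferentiableOn ℂ (fun z => deriv g z / g z) (ball 0 R) :=
    (hg.deriv.differentiableOn).div hg.differentiableOn hne
  obtain ⟨h, hh0, hh⟩ := hd.isExactOn_ball.with_val_at 0 0
  refine ⟨h, fun z hz => (hh z hz).differentiableAt.differentiableWithinAt, hh0, ?_⟩
  have key : ∀ z ∈ ball (0:ℂ) R, HasDerivAt (fun z => g z * Complex.exp (-h z)) 0 z := by
    intro z hz
    have := (hg z).hasDerivAt.mul ((hh z hz).neg.cexp)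
    refine this.congr_deriv ?_
    have := hne z hz
    field_simp
    ring
  intro z hz
  have := (convex_ball (0:ℂ) R).is_const_of_fderivWithin_eq_zero (𝕜 := ℂ)
    (f := fun z => g z * Complex.exp (-h z))
    (fun z hz => (key z hz).differentiableAt.differentiableWithinAt)
    (fun z hz => by
      rw [fderivWithin_of_isOpen isOpen_ball hz]
      have := (key z hz).hasFDerivAt.fderiv
      rw [this]; ext; simp) hz (mem_ball_self hR)
  simp only [h0, hh0, neg_zero, Complex.exp_zero, mul_one, Complex.exp_neg] at this
  have e := Complex.exp_ne_zero (h z)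
  field_simp at this
  exact this

lemma hadamard_bound (f : ℂ → ℂ) (hf : Differentiable ℂ f) (h0 : f 0 = 1)
    (hs : ∀ a, f a = 0 → deriv f a ≠ 0) (R B : ℝ) (hR : 0 < R) (hB : 0 < B)
    (hfB : ∀ z, ‖z‖ ≤ 2 * R → ‖f z‖ ≤ Real.exp B) (T : Finset ℂ)
    (hT : ∀ a, a ∈ T ↔ f a = 0 ∧ ‖a‖ ≤ R) (z : ℂ) (hz : ‖z‖ < R) :
    ∃ w : ℂ, f z = (∏ a ∈ T, (1 - z / a)) * Complex.exp w ∧ ‖w‖ ≤ 2 * B * ‖z‖ / (R - ‖z‖) := by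
  have hT0 : ∀ a ∈ T, f a = 0 := fun a ha => ((hT a).1 ha).1
  obtain ⟨g, hg, hfg⟩ := divide_zeros f hf h0 T hT0
  have hg0 : g 0 = 1 := by
    have := hfg 0
    simpa [h0] using this.symm
  have hgne : ∀ z ∈ ball (0:ℂ) R, g z ≠ 0 := fun z hz =>
    divide_ne_zero f h0 T hs g hg hfg z
      (fun h => (hT z).2 ⟨h, by simpa using (mem_ball_zero_iff.1 hz).le⟩)
  have hgB : ∀ z ∈ ball (0:ℂ) R, ‖g z‖ ≤ Real.exp B := by
    intro z hz
    refine Complex.norm_le_of_forall_mem_frontier_norm_le (U := ball (0:ℂ) (2 * R)) isBounded_ball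
      hg.diffContOnCl ?_ (subset_closure (ball_subset_ball (by linarith) hz))
    intro w hw
    rw [frontier_ball _ (by positivity), mem_sphere_zero_iff_norm] at hw
    have h1 := hfB w hw.le
    rw [hfg, norm_mul, norm_prod] at h1
    have h2 : 1 ≤ ∏ a ∈ T, ‖1 - w / a‖ := by
      apply Finset.one_le_prod
      intro a ha
      obtain ⟨hfa, haR⟩ := (hT a).1 ha
      have ha0 : a ≠ 0 := by
        rintro rfl
        simp [h0] at hfa
      have : 0 < ‖a‖ := norm_pos_iff.2 ha0
      have h3 : 2 ≤ ‖w / a‖ := by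
        rw [norm_div, hw, le_div_iff₀ this]; linarith
      have h4 := norm_sub_norm_le (w / a) 1
      rw [norm_sub_rev, norm_one] at h4
      linarith
    nlinarith [norm_nonneg (g w)]
  obtain ⟨h, hd, hh0, hgh⟩ := exists_log_ball g hg hg0 R hR hgne
  have hzb : z ∈ ball (0:ℂ) R := mem_ball_zero_iff.2 hz
  refine ⟨h z, by rw [hfg z, hgh z hzb], ?_⟩
  refine Complex.borelCaratheodory_zero hB hd ?_ hR hzb hh0
  intro w hw
  have := hgB w hw
  rw [hgh w hw, Complex.norm_exp, Real.exp_le_exp] at this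
  exact this

lemma one_add_sum_le_prod' {ι : Type*} (s : Finset ι) (f : ι → ℝ) (hf : ∀ i, 0 ≤ f i) :
    1 + ∑ i ∈ s, f i ≤ ∏ i ∈ s, (1 + f i) := by
  classical
  induction s using Finset.induction_on with
  | empty => simp
  | insert b s hb ih =>
    rw [Finset.sum_insert hb, Finset.prod_insert hb]
    have h1 := Finset.sum_nonneg (fun i (_ : i ∈ s) => hf i)
    nlinarith [hf b, mul_nonneg (hf b) h1]

theorem hadamard_prod (f : ℂ → ℂ) (hf : Differentiable ℂ f) (h0 : f 0 = 1)
    (hs : ∀ a, f a = 0 → deriv f a ≠ 0) (hp : ∀ a, f a = 0 → ∃ r : ℝ, 0 < r ∧ a = r)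
    (hg : ∀ ε > 0, ∃ C, ∀ z, ‖f z‖ ≤ C * Real.exp (ε * ‖z‖)) (z : ℂ) :
    HasProd (fun a : {a : ℂ // f a = 0} => 1 - z / (a : ℂ)) (f z) := by
  classical
  let T : ℕ → Finset ℂ := fun n => (zeros_finite f hf h0 n).toFinset
  have hT : ∀ n a, a ∈ T n ↔ f a = 0 ∧ ‖a‖ ≤ (n : ℝ) := by
    intro n a; simp [T]
  let U : ℕ → Finset {a : ℂ // f a = 0} := fun n => (T n).subtype _
  have hU : ∀ (F : ℂ → ℂ) n, ∏ a ∈ U n, F (a : ℂ) = ∏ a ∈ T n, F a := by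
    intro F n
    exact Finset.prod_subtype_of_mem F (fun a ha => ((hT n a).1 ha).1)
  have hUtop : Tendsto U atTop atTop := by
    refine tendsto_atTop_finset_of_monotone ?_ ?_
    · intro m n hmn a ha
      simp only [U, Finset.mem_subtype, hT] at ha ⊢
      exact ⟨ha.1, ha.2.trans (by exact_mod_cast hmn)⟩
    · intro a
      obtain ⟨n, hn⟩ := exists_nat_ge ‖(a : ℂ)‖
      exact ⟨n, by simp only [U, Finset.mem_subtype, hT]; exact ⟨a.2, hn⟩⟩
  -- convergence along T
  have hlim : ∀ z : ℂ, Tendsto (fun n => ∏ a ∈ T n, (1 - z / a)) atTop (𝓝 (f z)) := by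
    intro z
    have hex : ∀ n : ℕ, ‖z‖ < n → ∀ B > 0, (∀ z, ‖z‖ ≤ 2 * (n:ℝ) → ‖f z‖ ≤ Real.exp B) →
        ∃ w : ℂ, f z = (∏ a ∈ T n, (1 - z / a)) * Complex.exp w ∧
          ‖w‖ ≤ 2 * B * ‖z‖ / (n - ‖z‖) := fun n hn B hB hfB =>
      hadamard_bound f hf h0 hs n B ((norm_nonneg z).trans_lt hn) hB hfB (T n) (hT n) z hn
    have hsmall : ∀ δ > 0, ∀ᶠ n : ℕ in atTop, ∃ w : ℂ,
        f z = (∏ a ∈ T n, (1 - z / a)) * Complex.exp w ∧ ‖w‖ < δ := by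
      intro δ hδ
      -- choose ε
      set ε : ℝ := δ / (16 * (‖z‖ + 1)) with hε
      have hzn := norm_nonneg z
      have hε0 : 0 < ε := by positivity
      obtain ⟨C, hC⟩ := hg ε hε0
      have hCle : C ≤ Real.exp |C| := by
        have := Real.add_one_le_exp |C|
        have := le_abs_self C
        linarith
      have t1 : Tendsto (fun n : ℕ => (n : ℝ)) atTop atTop := tendsto_natCast_atTop_atTop
      filter_upwards [t1.eventually_gt_atTop (2 * ‖z‖), t1.eventually_gt_atTop (|C| / ε),
        t1.eventually_gt_atTop 0] with n hn1 hn2 hn3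
      obtain ⟨w, hw1, hw2⟩ := hex n (by linarith) (|C| + ε * (2 * n)) (by positivity) (by
        intro y hy
        refine (hC y).trans ?_
        rw [Real.exp_add]
        gcongr)
      refine ⟨w, hw1, hw2.trans_lt ?_⟩
      rw [div_lt_iff₀ hε0] at hn2
      have hδe : δ = 16 * ε * (‖z‖ + 1) := by rw [hε]; field_simp
      rw [div_lt_iff₀ (by linarith), hδe]
      have h1 : (|C| + ε * (2 * n)) * ‖z‖ ≤ (3 * ε * n) * ‖z‖ := by
        apply mul_le_mul_of_nonneg_right _ hzn
        linarith
      have h2 : 16 * ε * (‖z‖ + 1) * (n / 2) ≤ 16 * ε * (‖z‖ + 1) * (n - ‖z‖) := by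
        apply mul_le_mul_of_nonneg_left _ (by positivity)
        linarith
      have h3 : 0 < ε * n := by positivity
      nlinarith [mul_nonneg h3.le hzn]
    have hcont : Tendsto (fun w : ℂ => f z * Complex.exp (-w)) (𝓝 0) (𝓝 (f z)) := by
      have : Continuous (fun w : ℂ => f z * Complex.exp (-w)) := by fun_prop
      simpa using this.tendsto 0
    rw [Metric.tendsto_nhds]
    intro η hη
    obtain ⟨δ, hδ, hδ'⟩ := Metric.eventually_nhds_iff.1 (Metric.tendsto_nhds.1 hcont η hη)
    filter_upwards [hsmall δ hδ] with n hn
    obtain ⟨w, hw, hwδ⟩ := hn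
    have := @hδ' w (by simpa using hwδ)
    rw [hw, mul_assoc, ← Complex.exp_add] at this
    rw [hw]
    simpa using this
  have hsum : Summable (fun a : {a : ℂ // f a = 0} => ‖1 / (a : ℂ)‖) := by
    refine summable_of_sum_le (c := ‖f (-1)‖ + 1) (fun a => norm_nonneg _) ?_
    intro s
    have e1 := ((hlim (-1)).norm).eventually_lt_const (lt_add_one ‖f (-1)‖)
    obtain ⟨n, hn1, hn2⟩ := (e1.and (hUtop.eventually_ge_atTop s)).exists
    calc ∑ a ∈ s, ‖1 / (a : ℂ)‖ ≤ ∑ a ∈ U n, ‖1 / (a : ℂ)‖ :=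
          Finset.sum_le_sum_of_subset_of_nonneg hn2 (fun a _ _ => norm_nonneg _)
      _ ≤ ∏ a ∈ U n, (1 + ‖1 / (a : ℂ)‖) := by
          have := one_add_sum_le_prod' (U n) ( fun a => ‖1 / (a : ℂ)‖)
            (fun a => norm_nonneg _)
          linarith
      _ = ∏ a ∈ U n, ‖1 - (-1) / (a : ℂ)‖ := by
          refine Finset.prod_congr rfl fun a _ => ?_
          obtain ⟨r, hr, ha⟩ := hp a a.2
          rw [ha]
          have : (1 - (-1) / (r : ℂ)) = ((1 + 1 / r : ℝ) : ℂ) := by push_cast; ring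
          rw [this, Complex.norm_real, Real.norm_of_nonneg (by positivity)]
          simp [abs_of_pos hr]
      _ = ‖∏ a ∈ T n, (1 - (-1) / a)‖ := by
          rw [← hU (fun a => 1 - (-1) / a) n, norm_prod]
      _ ≤ _ := hn1.le
  have hm : Multipliable (fun a : {a : ℂ // f a = 0} => 1 - z / (a : ℂ)) := by
    have : Summable (fun a : {a : ℂ // f a = 0} => ‖-z / (a : ℂ)‖) := by
      refine (hsum.mul_left ‖z‖).congr fun a => ?_
      simp [div_eq_mul_inv]
    refine (multipliable_one_add_of_summable this).congr fun a => ?_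
    ring
  have h1 := hm.hasProd
  have h2 : Tendsto (fun n => ∏ a ∈ U n, (1 - z / (a : ℂ))) atTop (𝓝 _) := h1.comp hUtop
  have h3 := tendsto_nhds_unique h2 ((hlim z).congr fun n => (hU (fun a => 1 - z / a) n).symm)
  rwa [h3] at h1

noncomputable def cf (ν : ℝ) (m : ℕ) : ℝ := (-1 / 4) ^ m / (m.factorial * Real.Gamma (m + ν + 1))

noncomputable def FB (ν : ℝ) (z : ℂ) : ℂ := ∑' m : ℕ, (cf ν m : ℂ) * z ^ m

lemma gamma_pos' (ν : ℝ) (hν : -1 < ν) (m : ℕ) : 0 < Real.Gamma (m + ν + 1) := by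
  apply Real.Gamma_pos_of_pos
  have : (0:ℝ) ≤ m := Nat.cast_nonneg m
  linarith

lemma gamma_lower (ν : ℝ) (hν : -1 < ν) :
    ∃ δ > 0, ∀ m : ℕ, δ * m.factorial ≤ 4 ^ m * Real.Gamma (m + ν + 1) := by
  have g0 := gamma_pos' ν hν 0
  have g1 := gamma_pos' ν hν 1
  refine ⟨min (Real.Gamma ((0:ℕ) + ν + 1)) (Real.Gamma ((1:ℕ) + ν + 1)), lt_min g0 g1, ?_⟩
  intro m
  rcases m with _ | m
  · simp
  · induction m with
    | zero =>
      have := min_le_right (Real.Gamma ((0:ℕ) + ν + 1)) (Real.Gamma ((1:ℕ) + ν + 1))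
      simp only [zero_add, Nat.factorial_one, Nat.cast_one, mul_one, pow_one] at this g1 ⊢
      linarith
    | succ k ih =>
      have e : Real.Gamma (((k + 1 + 1 : ℕ) : ℝ) + ν + 1)
          = (((k + 1 : ℕ) : ℝ) + ν + 1) * Real.Gamma (((k + 1 : ℕ) : ℝ) + ν + 1) := by
        rw [← Real.Gamma_add_one]
        · congr 1; push_cast; ring
        · push_cast
          have : (0:ℝ) ≤ k := Nat.cast_nonneg k
          linarith
      have hk : (0:ℝ) ≤ k := Nat.cast_nonneg k
      have hG := gamma_pos' ν hν (k + 1)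
      rw [e, Nat.factorial_succ (k + 1), pow_succ]
      push_cast at ih hG ⊢
      have h3 : (k + 1 + 1 : ℝ) ≤ 4 * (k + 1 + ν + 1) := by linarith
      have h4 := mul_le_mul_of_nonneg_left ih (by linarith : (0:ℝ) ≤ k + 1 + 1)
      have h5 := mul_le_mul_of_nonneg_right h3
        (by positivity : 0 ≤ (4:ℝ) ^ (k + 1) * Real.Gamma (k + 1 + ν + 1))
      nlinarith

lemma cf_bound (ν : ℝ) (hν : -1 < ν) :
    ∃ C > 0, ∀ m : ℕ, |cf ν m| ≤ C / (m.factorial : ℝ) ^ 2 := by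
  obtain ⟨δ, hδ, h⟩ := gamma_lower ν hν
  refine ⟨1 / δ, by positivity, fun m => ?_⟩
  have hG := gamma_pos' ν hν m
  have hm : (0:ℝ) < m.factorial := by exact_mod_cast m.factorial_pos
  have e : |cf ν m| = 1 / (m.factorial * (4 ^ m * Real.Gamma (m + ν + 1))) := by
    rw [cf, abs_div, abs_pow, abs_of_pos (by positivity : 0 < m.factorial * Real.Gamma (m + ν + 1))]
    have : |(-1 / 4 : ℝ)| = 1 / 4 := by norm_num [abs_div]
    rw [this, div_pow, one_pow]
    field_simp
  rw [e, div_div]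
  apply one_div_le_one_div_of_le (by positivity)
  nlinarith [h m, mul_le_mul_of_nonneg_left (h m) hm.le]

lemma cf_summable (ν : ℝ) (hν : -1 < ν) (r : ℝ) (hr : 0 ≤ r) :
    Summable (fun m => |cf ν m| * r ^ m) := by
  obtain ⟨C, hC, h⟩ := cf_bound ν hν
  refine Summable.of_nonneg_of_le (fun m => by positivity) (fun m => ?_)
    ((Real.summable_pow_div_factorial r).mul_left C)
  have hm : (1:ℝ) ≤ m.factorial := by exact_mod_cast m.factorial_pos
  calc |cf ν m| * r ^ m ≤ C / (m.factorial : ℝ) ^ 2 * r ^ m := by gcongr; exact h m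
    _ ≤ C / (m.factorial : ℝ) * r ^ m := by
        gcongr
        nlinarith
    _ = _ := by ring

lemma FB_summable (ν : ℝ) (hν : -1 < ν) (z : ℂ) : Summable (fun m => (cf ν m : ℂ) * z ^ m) := by
  apply Summable.of_norm
  simpa using cf_summable ν hν ‖z‖ (norm_nonneg z)

lemma FB_growth (ν : ℝ) (hν : -1 < ν) (ε : ℝ) (hε : 0 < ε) :
    ∃ C, ∀ z, ‖FB ν z‖ ≤ C * Real.exp (ε * ‖z‖) := by
  obtain ⟨C, hC, h⟩ := cf_bound ν hν
  refine ⟨C * Real.exp (1 / ε), fun z => ?_⟩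
  have hs : HasSum (fun m : ℕ => (ε * ‖z‖) ^ m / m.factorial) (Real.exp (ε * ‖z‖)) := by
    rw [Real.exp_eq_exp_ℝ]
    exact NormedSpace.expSeries_div_hasSum_exp (ε * ‖z‖)
  refine tsum_of_norm_bounded (hs.mul_left (C * Real.exp (1 / ε))) fun m => ?_
  have hm : (0:ℝ) < m.factorial := by exact_mod_cast m.factorial_pos
  have h1 : (1 / ε) ^ m / m.factorial ≤ Real.exp (1 / ε) :=
    Real.pow_div_factorial_le_exp _ (by positivity) m
  rw [norm_mul, norm_pow, Complex.norm_real, Real.norm_eq_abs]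
  calc |cf ν m| * ‖z‖ ^ m ≤ C / (m.factorial : ℝ) ^ 2 * ‖z‖ ^ m := by gcongr; exact h m
    _ = C * ((1 / ε) ^ m / m.factorial) * ((ε * ‖z‖) ^ m / m.factorial) := by
        rw [mul_pow, div_pow, one_pow]; field_simp
    _ ≤ _ := by gcongr

lemma cf_succ (ν : ℝ) (m : ℕ) : ((m : ℝ) + 1) * cf ν (m + 1) = -1 / 4 * cf (ν + 1) m := by
  rw [cf, cf, Nat.factorial_succ]
  have e : (((m + 1 : ℕ) : ℝ) + ν + 1) = m + (ν + 1) + 1 := by push_cast; ring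
  rw [e]
  push_cast
  have : (m : ℝ) + 1 ≠ 0 := by positivity
  field_simp
  ring

lemma cf_rec (ν : ℝ) (hν : -1 < ν) (m : ℕ) : cf ν m = (m + ν + 1) * cf (ν + 1) m := by
  rw [cf, cf]
  have h0 : (m : ℝ) + ν + 1 ≠ 0 := by
    have : (0:ℝ) ≤ m := Nat.cast_nonneg m
    linarith
  have hG := (gamma_pos' ν hν m).ne'
  have e : (m : ℝ) + (ν + 1) + 1 = (m + ν + 1) + 1 := by ring
  rw [e, Real.Gamma_add_one h0]
  have hm : (m.factorial : ℝ) ≠ 0 := by positivity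
  field_simp

lemma FB_hasDerivAt (ν : ℝ) (hν : -1 < ν) (z : ℂ) :
    HasDerivAt (FB ν) (-1 / 4 * FB (ν + 1) z) z := by
  have hν1 : -1 < ν + 1 := by linarith
  set R := ‖z‖ + 1
  have hR : 0 ≤ R := by positivity
  have hterm : ∀ m : ℕ, ((m + 1 : ℕ) : ℂ) * (cf ν (m + 1) : ℂ) = -1 / 4 * (cf (ν + 1) m : ℂ) := by
    intro m
    have := cf_succ ν m
    exact_mod_cast congrArg (fun x : ℝ => (x : ℂ)) this
  have hu : Summable (fun m : ℕ => |cf ν m| * (m * R ^ (m - 1))) := by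
    rw [← summable_nat_add_iff 1]
    refine ((cf_summable (ν + 1) hν1 R hR).mul_left (1 / 4)).congr fun m => ?_
    have h1 := congrArg abs (cf_succ ν m)
    rw [abs_mul, abs_mul, abs_of_pos (by positivity : (0:ℝ) < m + 1)] at h1
    have : |(-1 / 4 : ℝ)| = 1 / 4 := by norm_num [abs_div]
    rw [this] at h1
    push_cast
    linear_combination (-(R ^ m)) * h1
  have key := hasDerivAt_tsum_of_isPreconnected (t := ball (0:ℂ) R)
    (g := fun m z => (cf ν m : ℂ) * z ^ m) (g' := fun m z => (cf ν m : ℂ) * (m * z ^ (m - 1)))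
    (y₀ := z) (y := z) hu isOpen_ball (convex_ball _ _).isPreconnected
    (fun m y _ => (hasDerivAt_pow m y).const_mul _)
    (fun m y hy => by
      have : ‖y‖ ≤ R := (mem_ball_zero_iff.1 hy).le
      simp only [norm_mul, Complex.norm_real, Real.norm_eq_abs, norm_pow, Complex.norm_natCast]
      gcongr)
    (by simp [R]) (FB_summable ν hν z) (by simp [R])
  refine HasDerivAt.congr_deriv (f' := ∑' m : ℕ, (cf ν m : ℂ) * (m * z ^ (m - 1))) key ?_
  have hs : Summable (fun m : ℕ => (cf ν m : ℂ) * (m * z ^ (m - 1))) := by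
    refine Summable.of_norm_bounded hu fun m => ?_
    simp only [norm_mul, Complex.norm_real, Real.norm_eq_abs, norm_pow, Complex.norm_natCast]
    have : ‖z‖ ≤ R := by simp [R]
    gcongr
  rw [hs.tsum_eq_zero_add, FB, ← tsum_mul_left]
  simp only [Nat.cast_zero, zero_mul, mul_zero, zero_add, Nat.add_sub_cancel]
  refine tsum_congr fun m => ?_
  linear_combination z ^ m * hterm m

lemma FB_rec (ν : ℝ) (hν : -1 < ν) (z : ℂ) :
    FB ν z = (ν + 1) * FB (ν + 1) z - z / 4 * FB (ν + 1 + 1) z := by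
  have hν1 : -1 < ν + 1 := by linarith
  have hν2 : -1 < ν + 1 + 1 := by linarith
  have s0 := FB_summable ν hν z
  have s1 := (FB_summable (ν + 1) hν1 z).mul_left ((ν : ℂ) + 1)
  have e : ∀ m : ℕ, (cf ν m : ℂ) * z ^ m - ((ν : ℂ) + 1) * ((cf (ν + 1) m : ℂ) * z ^ m)
      = m * (cf (ν + 1) m : ℂ) * z ^ m := by
    intro m
    rw [cf_rec ν hν m]; push_cast; ring
  have sd : Summable (fun m : ℕ => (m : ℂ) * (cf (ν + 1) m : ℂ) * z ^ m) :=
    (s0.sub s1).congr e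
  have h1 : FB ν z - (ν + 1) * FB (ν + 1) z = ∑' m : ℕ, (m : ℂ) * (cf (ν + 1) m : ℂ) * z ^ m := by
    rw [FB, FB, ← tsum_mul_left, ← s0.tsum_sub s1]
    exact tsum_congr e
  rw [sd.tsum_eq_zero_add] at h1
  have h2 : ∑' m : ℕ, ((m + 1 : ℕ) : ℂ) * (cf (ν + 1) (m + 1) : ℂ) * z ^ (m + 1)
      = - z / 4 * FB (ν + 1 + 1) z := by
    rw [FB, ← tsum_mul_left]
    refine tsum_congr fun m => ?_
    have := congrArg (fun x : ℝ => (x : ℂ)) (cf_succ (ν + 1) m)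
    push_cast at this ⊢
    linear_combination z ^ (m + 1) * this
  rw [h2] at h1
  simp only [Nat.cast_zero, zero_mul, zero_add] at h1
  linear_combination h1

lemma FB_differentiable (ν : ℝ) (hν : -1 < ν) : Differentiable ℂ (FB ν) :=
  fun z => (FB_hasDerivAt ν hν z).differentiableAt

lemma FB_zero (ν : ℝ) : FB ν 0 = ((1 / Real.Gamma (ν + 1) : ℝ) : ℂ) := by
  rw [FB, tsum_eq_single 0]
  · simp [cf]
  · intro m hm
    simp [hm]

lemma FB_zero_ne (ν : ℝ) (hν : -1 < ν) : FB ν 0 ≠ 0 := by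
  rw [FB_zero]
  have := gamma_pos' ν hν 0
  simp only [Nat.cast_zero, zero_add] at this
  exact_mod_cast (by positivity : 1 / Real.Gamma (ν + 1) ≠ 0)

lemma FB_iter (ν : ℝ) (hν : -1 < ν) (k : ℕ) :
    iteratedDeriv k (FB ν) = fun z => (-1 / 4) ^ k * FB (ν + k) z := by
  induction k with
  | zero => simp
  | succ k ih =>
    rw [iteratedDeriv_succ, ih]
    funext z
    have hk : -1 < ν + k := by
      have : (0:ℝ) ≤ k := Nat.cast_nonneg k
      linarith
    rw [((FB_hasDerivAt (ν + k) hk z).const_mul _).deriv]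
    push_cast
    rw [← add_assoc]
    ring

lemma FB_simple (ν : ℝ) (hν : -1 < ν) (a : ℂ) (ha : FB ν a = 0) : FB (ν + 1) a ≠ 0 := by
  intro h1
  have ha0 : a ≠ 0 := by
    rintro rfl
    exact FB_zero_ne ν hν ha
  have hall : ∀ k : ℕ, FB (ν + k) a = 0 ∧ FB (ν + k + 1) a = 0 := by
    intro k
    induction k with
    | zero => simpa using ⟨ha, h1⟩
    | succ k ih =>
      have hk : -1 < ν + k := by
        have : (0:ℝ) ≤ k := Nat.cast_nonneg k
        linarith
      have hr := FB_rec (ν + k) hk a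
      rw [ih.1, ih.2, mul_zero, zero_sub, eq_comm, neg_eq_zero, mul_eq_zero] at hr
      have e : ν + ((k + 1 : ℕ) : ℝ) = ν + k + 1 := by push_cast; ring
      rw [e]
      exact ⟨ih.2, hr.resolve_left (by simpa using ha0)⟩
  have ht := Complex.hasSum_taylorSeries_of_entire (FB_differentiable ν hν) a 0
  apply FB_zero_ne ν hν
  refine ht.unique ?_
  convert hasSum_zero with k
  rw [FB_iter ν hν]
  simp [(hall k).1]

lemma FB_real (ν : ℝ) (a : ℂ) (hν : -1 < ν) (ha : FB ν a = 0) : a.im = 0 := by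
  have hν1 : -1 < ν + 1 := by linarith
  have hν0 : 0 < ν + 1 := by linarith
  by_contra him
  let H : ℝ → ℂ := fun t => ((t ^ (ν + 1) : ℝ) : ℂ) * FB (ν + 1) (a * t)
  let K : ℝ → ℂ := fun t => FB ν (a * t)
  let w : ℝ → ℝ := fun t => (a * H t * star (K t)).im
  have hlin : ∀ t : ℝ, HasDerivAt (fun t : ℝ => a * (t : ℂ)) a t := fun t => by
    simpa using (Complex.ofRealCLM.hasDerivAt (x := t)).const_mul a
  have hK : ∀ t : ℝ, HasDerivAt K (-1 / 4 * FB (ν + 1) (a * t) * a) t := by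
    intro t
    have h2 := (FB_hasDerivAt ν hν (a * t)).comp t (hlin t)
    exact h2
  have hH : ∀ t : ℝ, 0 < t → HasDerivAt H (((t ^ ν : ℝ) : ℂ) * FB ν (a * t)) t := by
    intro t ht
    have h1 : HasDerivAt (fun t : ℝ => ((t ^ (ν + 1) : ℝ) : ℂ)) (((ν + 1) * t ^ ν : ℝ) : ℂ) t := by
      have := Real.hasDerivAt_rpow_const (x := t) (p := ν + 1) (Or.inl ht.ne')
      rw [add_sub_cancel_right] at this
      exact this.ofReal_comp
    have h2 := (FB_hasDerivAt (ν + 1) hν1 (a * t)).comp t (hlin t)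
    have h3 := h1.mul h2
    refine h3.congr_deriv ?_
    rw [FB_rec ν hν (a * t), Real.rpow_add_one ht.ne']
    simp only [Function.comp]
    push_cast
    ring
  have hw : ∀ t : ℝ, 0 < t → HasDerivAt w (a.im * (t ^ ν * ‖K t‖ ^ 2)) t := by
    intro t ht
    have h1 := ((hH t ht).const_mul a).mul (hK t).star
    have h2 := Complex.imCLM.hasFDerivAt.comp_hasDerivAt t h1
    refine h2.congr_deriv ?_
    simp only [Complex.imCLM_apply, H, K]
    rw [Real.rpow_add_one ht.ne', ← Complex.normSq_eq_norm_sq, Complex.normSq_apply]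
    generalize t ^ ν = s
    generalize FB ν (a * t) = p
    generalize FB (ν + 1) (a * t) = q
    simp
    ring
  have hcont : ContinuousOn w (Set.Icc 0 1) := by
    have hHc : Continuous H := by
      have c1 : Continuous (fun t : ℝ => t ^ (ν + 1)) := Real.continuous_rpow_const hν0.le
      have c2 : Continuous (FB (ν + 1)) := (FB_differentiable (ν + 1) hν1).continuous
      fun_prop
    have hKc : Continuous K := by
      have c2 : Continuous (FB ν) := (FB_differentiable ν hν).continuous
      fun_prop
    exact (Complex.continuous_im.comp ((continuous_const.mul hHc).mul hKc.star)).continuousOn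
  have hw0 : w 0 = 0 := by simp [w, H, Real.zero_rpow hν0.ne']
  have hw1 : w 1 = 0 := by simp [w, K, ha]
  -- Monotonicity of `a.im * w`
  have hmono : MonotoneOn (fun t => a.im * w t) (Set.Icc 0 1) := by
    refine monotoneOn_of_deriv_nonneg (convex_Icc 0 1) (continuousOn_const.mul hcont) ?_ ?_
    · intro t ht
      rw [interior_Icc] at ht
      exact ((hw t ht.1).const_mul _).differentiableAt.differentiableWithinAt
    · intro t ht
      rw [interior_Icc] at ht
      rw [((hw t ht.1).const_mul _).deriv]
      have := Real.rpow_nonneg ht.1.le ν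
      have e : a.im * (a.im * (t ^ ν * ‖K t‖ ^ 2)) = a.im ^ 2 * (t ^ ν * ‖K t‖ ^ 2) := by ring
      rw [e]; positivity
  have hzero : ∀ t ∈ Set.Icc (0:ℝ) 1, w t = 0 := by
    intro t ht
    have h1 := hmono (by simp) ht ht.1
    have h2 := hmono ht (by simp) ht.2
    simp only [hw0, hw1, mul_zero] at h1 h2
    exact (mul_eq_zero.1 (le_antisymm h2 h1)).resolve_left him
  have hKz : ∀ t ∈ Set.Ioo (0:ℝ) 1, K t = 0 := by
    intro t ht
    have h1 : HasDerivAt w 0 t := by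
      refine (hasDerivAt_const t (0:ℝ)).congr_of_eventuallyEq ?_
      filter_upwards [Icc_mem_nhds ht.1 ht.2] with s hs using hzero s hs
    have h2 := (hw t ht.1).unique h1
    have h3 : t ^ ν ≠ 0 := (Real.rpow_pos_of_pos ht.1 ν).ne'
    simpa [him, h3] using h2
  have hK0 : Tendsto K (𝓝[>] 0) (𝓝 (K 0)) :=
    (hK 0).continuousAt.continuousWithinAt
  have hK0' : Tendsto K (𝓝[>] 0) (𝓝 0) := by
    refine tendsto_const_nhds.congr' ?_
    filter_upwards [Ioo_mem_nhdsGT (zero_lt_one' ℝ)] with t ht using (hKz t ht).symm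
  have := tendsto_nhds_unique hK0 hK0'
  simp only [K, Complex.ofReal_zero, mul_zero] at this
  exact FB_zero_ne ν hν this

lemma FB_neg (ν : ℝ) (hν : -1 < ν) (r : ℝ) (hr : 0 ≤ r) : FB ν ((-r : ℝ) : ℂ) ≠ 0 := by
  have e : FB ν ((-r : ℝ) : ℂ) = ((∑' m : ℕ, cf ν m * (-r) ^ m : ℝ) : ℂ) := by
    rw [FB, Complex.ofReal_tsum]; push_cast; rfl
  have e2 : ∀ m : ℕ, cf ν m * (-r) ^ m = (r / 4) ^ m / (m.factorial * Real.Gamma (m + ν + 1)) := by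
    intro m
    rw [cf, div_mul_eq_mul_div, ← mul_pow]
    congr 2; ring
  have hnn : ∀ m : ℕ, 0 ≤ cf ν m * (-r) ^ m := by
    intro m
    rw [e2]
    have := gamma_pos' ν hν m
    positivity
  have hs : Summable (fun m : ℕ => cf ν m * (-r) ^ m) := by
    refine Summable.of_norm_bounded (cf_summable ν hν r hr) fun m => ?_
    simp [abs_of_nonneg hr]
  rw [e]
  have : 0 < ∑' m : ℕ, cf ν m * (-r) ^ m := by
    refine hs.tsum_pos hnn 0 ?_
    rw [e2]
    have := gamma_pos' ν hν 0
    positivity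
  exact_mod_cast this.ne'

lemma FB_pos_zero (ν : ℝ) (hν : -1 < ν) (a : ℂ) (ha : FB ν a = 0) : ∃ r : ℝ, 0 < r ∧ a = r := by
  have him := FB_real ν a hν ha
  have e : a = ((a.re : ℝ) : ℂ) := by
    apply Complex.ext <;> simp [him]
  refine ⟨a.re, ?_, e⟩
  by_contra h
  apply FB_neg ν hν (-a.re) (by linarith)
  rw [neg_neg, ← e]
  exact ha

lemma besselJ_eq (ν x : ℝ) (hx : 0 < x) :
    FB ν ((x ^ 2 : ℝ) : ℂ) = (((x / 2) ^ (-ν) * besselJ ν x : ℝ) : ℂ) := by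
  have e : FB ν ((x ^ 2 : ℝ) : ℂ) = ((∑' m : ℕ, cf ν m * (x ^ 2) ^ m : ℝ) : ℂ) := by
    rw [FB, Complex.ofReal_tsum]; push_cast; rfl
  rw [e, besselJ, ← tsum_mul_left]
  congr 1
  refine tsum_congr fun m => ?_
  have h2 : 0 < x / 2 := by positivity
  have e1 : (x / 2) ^ (2 * (m : ℝ) + ν) = ((x / 2) ^ 2) ^ m * (x / 2) ^ ν := by
    rw [Real.rpow_add h2, ← pow_mul, ← Real.rpow_natCast]
    push_cast; rfl
  have e2 : (x / 2) ^ (-ν) * (x / 2) ^ ν = 1 := by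
    rw [← Real.rpow_add h2]; simp
  have e3 : (-1 / 4 : ℝ) ^ m * (x ^ 2) ^ m = (-1) ^ m * ((x / 2) ^ 2) ^ m := by
    rw [← mul_pow, ← mul_pow]; congr 1; ring
  rw [e1, cf]
  calc _ = ((-1 / 4 : ℝ) ^ m * (x ^ 2) ^ m) / (m.factorial * Real.Gamma (m + ν + 1)) := by ring
    _ = ((-1) ^ m * ((x / 2) ^ 2) ^ m) / (m.factorial * Real.Gamma (m + ν + 1)) *
        ((x / 2) ^ (-ν) * (x / 2) ^ ν) := by rw [e2, e3, mul_one]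
    _ = _ := by ring

lemma besselI_eq (ν x : ℝ) (hx : 0 < x) :
    FB ν ((-x ^ 2 : ℝ) : ℂ) = (((x / 2) ^ (-ν) * besselI ν x : ℝ) : ℂ) := by
  have e : FB ν ((-x ^ 2 : ℝ) : ℂ) = ((∑' m : ℕ, cf ν m * (-x ^ 2) ^ m : ℝ) : ℂ) := by
    rw [FB, Complex.ofReal_tsum]; push_cast; rfl
  rw [e, besselI, ← tsum_mul_left]
  congr 1
  refine tsum_congr fun m => ?_
  have h2 : 0 < x / 2 := by positivity
  have e1 : (x / 2) ^ (2 * (m : ℝ) + ν) = ((x / 2) ^ 2) ^ m * (x / 2) ^ ν := by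
    rw [Real.rpow_add h2, ← pow_mul, ← Real.rpow_natCast]
    push_cast; rfl
  have e2 : (x / 2) ^ (-ν) * (x / 2) ^ ν = 1 := by
    rw [← Real.rpow_add h2]; simp
  have e3 : (-1 / 4 : ℝ) ^ m * (-x ^ 2) ^ m = ((x / 2) ^ 2) ^ m := by
    rw [← mul_pow]; congr 1; ring
  rw [e1, cf]
  calc _ = ((-1 / 4 : ℝ) ^ m * (-x ^ 2) ^ m) / (m.factorial * Real.Gamma (m + ν + 1)) := by ring
    _ = (((x / 2) ^ 2) ^ m) / (m.factorial * Real.Gamma (m + ν + 1)) *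
        ((x / 2) ^ (-ν) * (x / 2) ^ ν) := by rw [e2, e3, mul_one]
    _ = _ := by ring

lemma FB_zero_iff (ν x : ℝ) (hx : 0 < x) : FB ν ((x ^ 2 : ℝ) : ℂ) = 0 ↔ besselJ ν x = 0 := by
  rw [besselJ_eq ν x hx, Complex.ofReal_eq_zero, mul_eq_zero]
  have : (x / 2) ^ (-ν) ≠ 0 := (Real.rpow_pos_of_pos (by positivity) _).ne'
  tauto

theorem quartic_weierstrass_product (ν : ℝ) (hν : -1 < ν) (x : ℝ) (hx : 0 < x) :
    Multipliable (fun j : {j : ℝ // 0 < j ∧ besselJ ν j = 0} =>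
        1 - x ^ 4 / (j : ℝ) ^ 4) ∧
      ∏' j : {j : ℝ // 0 < j ∧ besselJ ν j = 0}, (1 - x ^ 4 / (j : ℝ) ^ 4)
        = (2 : ℝ) ^ (2 * ν) * Real.Gamma (ν + 1) ^ 2 * x ^ (-(2 * ν)) *
            besselJ ν x * besselI ν x := by
  have hG : 0 < Real.Gamma (ν + 1) := by simpa using gamma_pos' ν hν 0
  have hGc : (Real.Gamma (ν + 1) : ℂ) ≠ 0 := by exact_mod_cast hG.ne'
  let f : ℂ → ℂ := fun z => Real.Gamma (ν + 1) * FB ν z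
  have hf0 : ∀ a, f a = 0 ↔ FB ν a = 0 := by
    intro a; simp only [f, mul_eq_zero, hGc, false_or]
  have hprod := hadamard_prod f ((FB_differentiable ν hν).const_mul _)
    (by simp only [f]; rw [FB_zero]; push_cast; field_simp)
    (by
      intro a ha
      have h1 := ((FB_hasDerivAt ν hν a).const_mul (Real.Gamma (ν + 1) : ℂ)).deriv
      have h2 := FB_simple ν hν a ((hf0 a).1 ha)
      refine ne_of_eq_of_ne h1 ?_
      exact mul_ne_zero hGc (mul_ne_zero (by norm_num) h2))
    (fun a ha => FB_pos_zero ν hν a ((hf0 a).1 ha))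
    (by
      intro ε hε
      obtain ⟨C, hC⟩ := FB_growth ν hν ε hε
      refine ⟨Real.Gamma (ν + 1) * C, fun z => ?_⟩
      simp only [f]
      rw [norm_mul, Complex.norm_real, Real.norm_of_nonneg hG.le, mul_assoc]
      exact mul_le_mul_of_nonneg_left (hC z) hG.le)
  let φ : {j : ℝ // 0 < j ∧ besselJ ν j = 0} → {a : ℂ // f a = 0} := fun j =>
    ⟨((j.1 ^ 2 : ℝ) : ℂ), (hf0 _).2 ((FB_zero_iff ν j.1 j.2.1).2 j.2.2)⟩
  have hφ : Function.Bijective φ := by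
    constructor
    · intro i j hij
      have h1 : ((i.1 ^ 2 : ℝ) : ℂ) = ((j.1 ^ 2 : ℝ) : ℂ) := congrArg Subtype.val hij
      have h2 : i.1 ^ 2 = j.1 ^ 2 := by exact_mod_cast h1
      exact Subtype.ext ((sq_eq_sq₀ i.2.1.le j.2.1.le).1 h2)
    · rintro ⟨a, ha⟩
      obtain ⟨r, hr, rfl⟩ := FB_pos_zero ν hν a ((hf0 a).1 ha)
      have hs : Real.sqrt r ^ 2 = r := Real.sq_sqrt hr.le
      have hp := Real.sqrt_pos.2 hr
      refine ⟨⟨Real.sqrt r, hp, ?_⟩, ?_⟩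
      · rw [← FB_zero_iff ν _ hp, hs]
        exact (hf0 _).1 ha
      · apply Subtype.ext
        simp only [φ, hs]
  have h3 := (hprod ((x ^ 2 : ℝ) : ℂ)).mul (hprod ((-x ^ 2 : ℝ) : ℂ))
  have h4 := (Equiv.hasProd_iff (Equiv.ofBijective φ hφ)).2 h3
  have h5 : HasProd (fun j : {j : ℝ // 0 < j ∧ besselJ ν j = 0} =>
        ((1 - x ^ 4 / (j : ℝ) ^ 4 : ℝ) : ℂ))
      (((2 : ℝ) ^ (2 * ν) * Real.Gamma (ν + 1) ^ 2 * x ^ (-(2 * ν)) *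
            besselJ ν x * besselI ν x : ℝ) : ℂ) := by
    convert h4 using 1
    · funext j
      have hj : (j.1 : ℂ) ≠ 0 := by exact_mod_cast j.2.1.ne'
      simp only [Function.comp, Equiv.ofBijective_apply, φ]
      push_cast
      field_simp
      ring
    · simp only [f]
      rw [besselJ_eq ν x hx, besselI_eq ν x hx]
      norm_cast
      have e : (2 : ℝ) ^ (2 * ν) * x ^ (-(2 * ν)) = (x / 2) ^ (-ν) * (x / 2) ^ (-ν) := by
        rw [← Real.rpow_add (by positivity), Real.div_rpow hx.le (by norm_num)]
        have : -ν + -ν = -(2 * ν) := by ring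
        rw [this, Real.rpow_neg (by norm_num : (0:ℝ) ≤ 2) (2 * ν), div_inv_eq_mul, mul_comm]
      linear_combination Real.Gamma (ν + 1) ^ 2 * besselJ ν x * besselI ν x * e
  have h6 : HasProd (fun j : {j : ℝ // 0 < j ∧ besselJ ν j = 0} => 1 - x ^ 4 / (j : ℝ) ^ 4)
      ((2 : ℝ) ^ (2 * ν) * Real.Gamma (ν + 1) ^ 2 * x ^ (-(2 * ν)) *
            besselJ ν x * besselI ν x) := by
    unfold HasProd at h5 ⊢
    have h7 := (Complex.continuous_re.tendsto _).comp h5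
    rw [Complex.ofReal_re] at h7
    refine h7.congr fun s => ?_
    simp only [Function.comp]
    rw [← Complex.ofReal_prod, Complex.ofReal_re]
  exact ⟨h6.multipliable, h6.tprod_eq⟩
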